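/- Let 1/4 < s' ≤ 1/2 and 1/2 < θ₁ < 3/4. Then for every ε > 0 there exists a constant C > 0 such that for all Schwartz functions v, w on ℝ^{1+2}, ‖vw‖_{H^{2s'−3/4−ε, 0}} ≤ C ‖v‖_{H^{s',θ₁}} ‖w‖_{H^{s',θ₁}}. -/

import Mathlib

open MeasureTheory Real
open scoped FourierTransform

noncomputable section

/-- Space-time ℝ^{1+2}: coordinate 0 is time `t`, coordinates 1,2 are space `x`. -/
abbrev SpaceTime := EuclideanSpace ℝ (Fin 3)

/-- The magnitude `|ξ|` of the spatial part of a frequency point `(τ, ξ) ∈ ℝ × ℝ²`. -/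
def spFreq (ζ : SpaceTime) : ℝ := Real.sqrt ((ζ 1) ^ 2 + (ζ 2) ^ 2)

/-- The wave-Sobolev norm
`‖u‖_{H^{s,b}} = (∫ (1+|ξ|²)^s (1+||τ|-|ξ||)^{2b} |û(τ,ξ)|² dτ dξ)^{1/2}`. -/
def waveNorm (s b : ℝ) (f : SpaceTime → ℂ) : ℝ :=
  (∫ ζ : SpaceTime, (1 + (spFreq ζ) ^ 2) ^ s * (1 + |(|ζ 0| - spFreq ζ)|) ^ (2 * b) *
    ‖𝓕 f ζ‖ ^ 2) ^ (1/2 : ℝ)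

open scoped ENNReal

theorem fourier_fourier_apply (v : SchwartzMap SpaceTime ℂ) (x : SpaceTime) :
    𝓕 (𝓕 v) x = v (-x) := by
  have h : 𝓕⁻ (𝓕 v) (-x) = v (-x) := by simp
  rw [← h, SchwartzMap.fourierInv_coe, Real.fourierInv_eq_fourier_neg, neg_neg,
    ← SchwartzMap.fourier_coe]

theorem fourier_mul_eq_integral (v w : SchwartzMap SpaceTime ℂ) (ζ : SpaceTime) :
    𝓕 (fun x => v x * w x) ζ = ∫ η, 𝓕 (fun x => v x) η * 𝓕 (fun x => w x) (ζ - η) := by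
  have h := SchwartzMap.convolution_apply (ContinuousLinearMap.mul ℂ ℂ) (𝓕 v) (𝓕 w) ζ
  have h2 : SchwartzMap.convolution (ContinuousLinearMap.mul ℂ ℂ) (𝓕 v) (𝓕 w) =
    𝓕⁻ (SchwartzMap.pairing (ContinuousLinearMap.mul ℂ ℂ) (𝓕 (𝓕 v)) (𝓕 (𝓕 w))) := rfl
  rw [h2, SchwartzMap.fourierInv_coe, Real.fourierInv_eq_fourier_comp_neg] at h
  simpa [SchwartzMap.pairing_apply_apply, fourier_fourier_apply, convolution,
    SchwartzMap.fourier_coe] using h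

theorem enorm_fourier_mul_le (v w : SchwartzMap SpaceTime ℂ) (ζ : SpaceTime) :
    ‖𝓕 (fun x => v x * w x) ζ‖ₑ ≤
      ∫⁻ η, ‖𝓕 (fun x => v x) η‖ₑ * ‖𝓕 (fun x => w x) (ζ - η)‖ₑ := by
  rw [fourier_mul_eq_integral]
  refine (enorm_integral_le_lintegral_enorm _).trans_eq ?_
  simp

/-- Cauchy–Schwarz -/
theorem sq_lintegral_mul_le {α : Type*} [MeasurableSpace α] {μ : Measure α} {f g : α → ℝ≥0∞}
    (hf : AEMeasurable f μ) (hg : AEMeasurable g μ) :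
    (∫⁻ a, f a * g a ∂μ) ^ 2 ≤ (∫⁻ a, f a ^ 2 ∂μ) * ∫⁻ a, g a ^ 2 ∂μ := by
  have h := ENNReal.lintegral_mul_le_Lp_mul_Lq μ Real.HolderConjugate.two_two hf hg
  calc _ ≤ ((∫⁻ a, f a ^ (2:ℝ) ∂μ) ^ (1 / 2 : ℝ) * (∫⁻ a, g a ^ (2:ℝ) ∂μ) ^ (1 / 2 : ℝ)) ^ 2 := by
        gcongr; exact h
    _ = _ := by
        rw [mul_pow, ← ENNReal.rpow_natCast, ← ENNReal.rpow_natCast, ← ENNReal.rpow_mul,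
          ← ENNReal.rpow_mul]
        norm_num

theorem sq_tsum_mul_le {ι : Type*} (f g : ι → ℝ≥0∞) :
    (∑' i, f i * g i) ^ 2 ≤ (∑' i, f i ^ 2) * ∑' i, g i ^ 2 := by
  let _ : MeasurableSpace ι := ⊤
  have hm : ∀ f : ι → ℝ≥0∞, Measurable f := fun f => measurable_from_top
  have : MeasurableSingletonClass ι := ⟨fun _ => trivial⟩
  simpa [lintegral_count] using
    sq_lintegral_mul_le (μ := Measure.count) (hm f).aemeasurable (hm g).aemeasurable

theorem le_mul_of_sq_le {a b c : ℝ≥0∞} (h : a ^ 2 ≤ b ^ 2 * c ^ 2) : a ≤ b * c := by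
  rw [← mul_pow] at h
  exact (ENNReal.pow_le_pow_left_iff two_ne_zero).1 h

/-- A bilinear estimate for almost orthogonal pieces. -/
theorem lintegral_sq_conv_le {κ : SpaceTime → ℤ} (hκ : Measurable κ) {A : Set SpaceTime}
    (hA : MeasurableSet A) (hAκ : ∀ ζ ∈ A, ∀ η, |κ (ζ - η) - κ η| ≤ 1)
    {k F G : SpaceTime → ℝ≥0∞} (hk : Measurable k) (hF : Measurable F) (hG : Measurable G)
    {B : ℝ≥0∞} (hB : ∀ ζ ∈ A, ∀ n : ℤ, ∫⁻ η in κ ⁻¹' {n}, k η ^ 2 * k (ζ - η) ^ 2 ≤ B) :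
    ∫⁻ ζ in A, (∫⁻ η, (k η * F η) * (k (ζ - η) * G (ζ - η))) ^ 2 ≤
      3 * B * (∫⁻ η, F η ^ 2) * ∫⁻ η, G η ^ 2 := by
  set S : ℤ → Set SpaceTime := fun n => κ ⁻¹' {n} with hS
  set S' : ℤ → Set SpaceTime := fun n => κ ⁻¹' {m | |m - n| ≤ 1} with hS'
  have hSm : ∀ n, MeasurableSet (S n) := fun n => hκ (measurableSet_singleton n)
  have hSm' : ∀ n, MeasurableSet (S' n) := fun n => hκ (Set.to_countable _).measurableSet
  set Fn : ℤ → SpaceTime → ℝ≥0∞ := fun n => (S n).indicator F with hFn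
  set Gn : ℤ → SpaceTime → ℝ≥0∞ := fun n => (S' n).indicator G with hGn
  have hFnm : ∀ n, Measurable (Fn n) := fun n => hF.indicator (hSm n)
  have hGnm : ∀ n, Measurable (Gn n) := fun n => hG.indicator (hSm' n)
  set H : ℤ → SpaceTime → ℝ≥0∞ :=
    fun n ζ => ∫⁻ η, (k η * Fn n η) * (k (ζ - η) * Gn n (ζ - η)) with hH
  have hHm : ∀ n, Measurable (H n) := by
    intro n
    have := hFnm n
    have := hGnm n
    apply Measurable.lintegral_prod_right' (f := fun p : SpaceTime × SpaceTime =>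
      (k p.2 * Fn n p.2) * (k (p.1 - p.2) * Gn n (p.1 - p.2)))
    fun_prop
  have hsum : ∀ ζ ∈ A, ∫⁻ η, (k η * F η) * (k (ζ - η) * G (ζ - η)) = ∑' n, H n ζ := by
    intro ζ hζ
    rw [← lintegral_tsum]
    · congr 1 with η
      rw [tsum_eq_single (κ η)]
      · have h1 : η ∈ S (κ η) := rfl
        have h2 : ζ - η ∈ S' (κ η) := hAκ ζ hζ η
        simp only [hFn, hGn, Set.indicator_of_mem h1, Set.indicator_of_mem h2]
      · intro n hn
        have h1 : η ∉ S n := fun h => hn h.symm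
        simp only [hFn, Set.indicator_of_notMem h1, mul_zero, zero_mul]
    · intro n
      have := hFnm n
      have := hGnm n
      fun_prop
  set a : ℤ → ℝ≥0∞ := fun n => ∫⁻ η, Fn n η ^ 2 with ha
  set b : ℤ → ℝ≥0∞ := fun n => ∫⁻ η, Gn n η ^ 2 with hb
  have hHsq : ∀ n, ∫⁻ ζ in A, H n ζ ^ 2 ≤ B * (a n * b n) := by
    intro n
    have m1 := hFnm n
    have m2 := hGnm n
    have h1 : ∀ ζ ∈ A, H n ζ ^ 2 ≤ B * ∫⁻ η, Fn n η ^ 2 * Gn n (ζ - η) ^ 2 := by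
      intro ζ hζ
      have e : H n ζ = ∫⁻ η, ((S n).indicator k η * k (ζ - η)) * (Fn n η * Gn n (ζ - η)) := by
        simp only [hH]
        congr 1 with η
        by_cases h : η ∈ S n
        · simp only [Set.indicator_of_mem h]; ring
        · simp [hFn, h]
      rw [e]
      have m3 := hk.indicator (hSm n)
      refine (sq_lintegral_mul_le (by fun_prop) (by fun_prop)).trans ?_
      simp only [mul_pow]
      gcongr
      refine le_trans (le_of_eq ?_) (hB ζ hζ n)
      rw [← lintegral_indicator (hSm n)]
      congr 1 with η
      by_cases h : η ∈ S n <;> simp [h]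
    calc ∫⁻ ζ in A, H n ζ ^ 2 ≤ ∫⁻ ζ in A, B * ∫⁻ η, Fn n η ^ 2 * Gn n (ζ - η) ^ 2 :=
          setLIntegral_mono' hA h1
      _ ≤ ∫⁻ ζ, B * ∫⁻ η, Fn n η ^ 2 * Gn n (ζ - η) ^ 2 := setLIntegral_le_lintegral _ _
      _ = B * ∫⁻ ζ, ∫⁻ η, Fn n η ^ 2 * Gn n (ζ - η) ^ 2 := by
          rw [lintegral_const_mul]
          apply Measurable.lintegral_prod_right' (f := fun p : SpaceTime × SpaceTime =>
            Fn n p.2 ^ 2 * Gn n (p.1 - p.2) ^ 2)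
          fun_prop
      _ = B * (a n * b n) := by
          congr 1
          rw [lintegral_lintegral_swap (by fun_prop)]
          have : ∀ η, ∫⁻ ζ, Fn n η ^ 2 * Gn n (ζ - η) ^ 2 = Fn n η ^ 2 * b n := by
            intro η
            rw [lintegral_const_mul _ (by fun_prop),
              lintegral_sub_right_eq_self (fun ζ => Gn n ζ ^ 2) η]
          simp_rw [this]
          rw [lintegral_mul_const _ (by fun_prop)]
  set c : ℤ → ℝ≥0∞ := fun n => (B * (a n * b n)) ^ (1 / 2 : ℝ) with hc
  have sqrt_sq : ∀ x : ℝ≥0∞, (x ^ (1 / 2 : ℝ)) ^ 2 = x := by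
    intro x
    rw [← ENNReal.rpow_natCast, ← ENNReal.rpow_mul]
    norm_num
  have hcross : ∀ n m, ∫⁻ ζ in A, H n ζ * H m ζ ≤ c n * c m := by
    intro n m
    apply le_mul_of_sq_le
    simp only [hc, sqrt_sq]
    exact (sq_lintegral_mul_le (hHm n).aemeasurable (hHm m).aemeasurable).trans
      (mul_le_mul' (hHsq n) (hHsq m))
  have hmain : ∫⁻ ζ in A, (∑' n, H n ζ) ^ 2 ≤ (∑' n, c n) ^ 2 := by
    calc ∫⁻ ζ in A, (∑' n, H n ζ) ^ 2 = ∫⁻ ζ in A, ∑' n, ∑' m, H n ζ * H m ζ := by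
          congr 1 with ζ
          rw [sq, ← ENNReal.tsum_mul_right]
          simp_rw [ENNReal.tsum_mul_left]
      _ = ∑' n, ∑' m, ∫⁻ ζ in A, H n ζ * H m ζ := by
          rw [lintegral_tsum]
          · congr 1 with n
            rw [lintegral_tsum]
            intro m
            exact ((hHm n).mul (hHm m)).aemeasurable
          · intro n
            exact (Measurable.tsum fun m => (hHm n).mul (hHm m)).aemeasurable
      _ ≤ ∑' n, ∑' m, c n * c m :=
          ENNReal.tsum_le_tsum fun n => ENNReal.tsum_le_tsum fun m => hcross n m
      _ = (∑' n, c n) ^ 2 := by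
          rw [sq, ← ENNReal.tsum_mul_right]
          simp_rw [ENNReal.tsum_mul_left]
  have hc2 : (∑' n, c n) ^ 2 ≤ B * ((∑' n, a n) * ∑' n, b n) := by
    have e : ∀ n, c n = B ^ (1 / 2 : ℝ) * (a n ^ (1 / 2 : ℝ) * b n ^ (1 / 2 : ℝ)) := by
      intro n
      simp only [hc]
      rw [ENNReal.mul_rpow_of_nonneg _ _ (by norm_num), ENNReal.mul_rpow_of_nonneg _ _ (by norm_num)]
    simp_rw [e]
    rw [ENNReal.tsum_mul_left, mul_pow, sqrt_sq]
    gcongr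
    simpa only [sqrt_sq] using sq_tsum_mul_le (fun n => a n ^ (1 / 2 : ℝ)) (fun n => b n ^ (1 / 2 : ℝ))
  have hsa : ∑' n, a n = ∫⁻ η, F η ^ 2 := by
    simp only [ha]
    rw [← lintegral_tsum fun n => ((hFnm n).pow_const 2).aemeasurable]
    congr 1 with η
    rw [tsum_eq_single (κ η)]
    · simp [hFn, hS]
    · intro n hn
      have h1 : η ∉ S n := fun h => hn h.symm
      simp [hFn, h1]
  have hsb : ∑' n, b n ≤ 3 * ∫⁻ η, G η ^ 2 := by
    simp only [hb]
    rw [← lintegral_tsum fun n => ((hGnm n).pow_const 2).aemeasurable,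
      ← lintegral_const_mul _ (hG.pow_const 2)]
    gcongr with η
    rw [tsum_eq_sum (s := Finset.Icc (κ η - 1) (κ η + 1))]
    · calc _ ≤ ∑ n ∈ Finset.Icc (κ η - 1) (κ η + 1), G η ^ 2 := by
            gcongr
            exact Set.indicator_le_self _ _ _
        _ = _ := by
            rw [Finset.sum_const, Int.card_Icc, nsmul_eq_mul,
              show κ η + 1 + 1 - (κ η - 1) = 3 by ring, show Int.toNat 3 = 3 from rfl]
            norm_cast
    · intro n hn
      have h1 : η ∉ S' n := by
        intro h
        apply hn
        have h : |κ η - n| ≤ 1 := h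
        rw [abs_le] at h
        rw [Finset.mem_Icc]
        omega
      simp [hGn, h1]
  calc _ = ∫⁻ ζ in A, (∑' n, H n ζ) ^ 2 :=
        setLIntegral_congr_fun hA fun ζ hζ => by rw [hsum ζ hζ]
    _ ≤ B * ((∑' n, a n) * ∑' n, b n) := hmain.trans hc2
    _ ≤ B * ((∫⁻ η, F η ^ 2) * (3 * ∫⁻ η, G η ^ 2)) := by rw [hsa]; gcongr
    _ = _ := by ring

theorem lintegral_Ioo_rpow_neg {q L : ℝ} (hq1 : q < 1) (hL : 0 < L) :
    ∫⁻ r, (Set.Ioo 0 L).indicator (fun r => ENNReal.ofReal (r ^ (-q))) r =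
      ENNReal.ofReal (L ^ (1 - q) / (1 - q)) := by
  rw [lintegral_indicator measurableSet_Ioo, restrict_Ioo_eq_restrict_Ioc]
  have hi : IntervalIntegrable (fun r : ℝ => r ^ (-q)) volume 0 L :=
    intervalIntegral.intervalIntegrable_rpow' (by linarith)
  rw [← ofReal_integral_eq_lintegral_ofReal]
  · rw [← intervalIntegral.integral_of_le hL.le, integral_rpow (Or.inl (by linarith))]
    rw [show -q + 1 = 1 - q by ring, Real.zero_rpow (by linarith), sub_zero]
  · exact (intervalIntegrable_iff_integrableOn_Ioc_of_le hL.le).1 hi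
  · filter_upwards [self_mem_ae_restrict measurableSet_Ioc] with r hr
    exact Real.rpow_nonneg hr.1.le _

/-- Uniform bound for the integral of a weakly singular power on an interval of length `L`. -/
theorem lintegral_Ico_abs_sub_rpow_neg_le {q L : ℝ} (hq0 : 0 < q) (hq1 : q < 1) (hL : 0 < L)
    (x m : ℝ) :
    ∫⁻ r in Set.Ico m (m + L), ENNReal.ofReal (|r - x| ^ (-q)) ≤
      ENNReal.ofReal ((2 / (1 - q) + 1) * L ^ (1 - q)) := by
  set g : ℝ → ℝ≥0∞ := (Set.Ioo 0 L).indicator (fun r => ENNReal.ofReal (r ^ (-q))) with hg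
  have hgm : Measurable g := by
    refine Measurable.indicator ?_ measurableSet_Ioo
    fun_prop
  have hLq : 0 < L ^ (1 - q) := Real.rpow_pos_of_pos hL _
  have key : ∀ r, ENNReal.ofReal (|r - x| ^ (-q)) ≤
      g (r - x) + g (x - r) + ENNReal.ofReal (L ^ (-q)) := by
    intro r
    rcases le_or_gt L (|r - x|) with h | h
    · refine le_add_left (ENNReal.ofReal_le_ofReal ?_)
      exact Real.rpow_le_rpow_of_nonpos hL h (by linarith)
    · refine le_add_right ?_
      rcases lt_trichotomy r x with h' | h' | h'
      · rw [abs_of_neg (by linarith), neg_sub] at h ⊢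
        refine le_add_left ?_
        rw [hg, Set.indicator_of_mem (show x - r ∈ Set.Ioo 0 L from ⟨by linarith, h⟩)]
      · simp [h', Real.zero_rpow (show -q ≠ 0 by linarith)]
      · rw [abs_of_pos (by linarith)] at h ⊢
        refine le_add_right ?_
        rw [hg, Set.indicator_of_mem (show r - x ∈ Set.Ioo 0 L from ⟨by linarith, h⟩)]
  calc _ ≤ ∫⁻ r in Set.Ico m (m + L), (g (r - x) + g (x - r) + ENNReal.ofReal (L ^ (-q))) :=
        lintegral_mono key
    _ = (∫⁻ r in Set.Ico m (m + L), g (r - x)) + (∫⁻ r in Set.Ico m (m + L), g (x - r)) +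
          ENNReal.ofReal (L ^ (-q)) * ENNReal.ofReal L := by
        rw [lintegral_add_left (by fun_prop), lintegral_add_left (by fun_prop),
          setLIntegral_const, Real.volume_Ico, add_sub_cancel_left]
    _ ≤ (∫⁻ r, g (r - x)) + (∫⁻ r, g (x - r)) + ENNReal.ofReal (L ^ (-q)) * ENNReal.ofReal L := by
        gcongr <;> exact Measure.restrict_le_self
    _ = ENNReal.ofReal (L ^ (1 - q) / (1 - q)) + ENNReal.ofReal (L ^ (1 - q) / (1 - q)) +
          ENNReal.ofReal (L ^ (1 - q)) := by
        rw [lintegral_sub_right_eq_self g, lintegral_sub_left_eq_self g,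
          lintegral_Ioo_rpow_neg hq1 hL, ← ENNReal.ofReal_mul (by positivity)]
        congr 2
        rw [← Real.rpow_add_one hL.ne']
        congr 1
        ring
    _ = _ := by
        have : 0 < 1 - q := by linarith
        rw [← ENNReal.ofReal_add (by positivity) (by positivity),
          ← ENNReal.ofReal_add (by positivity) (by positivity)]
        congr 1
        ring

theorem sq_sub_le_cos_sub_cos {x y : ℝ} (hx : 0 ≤ x) (hxy : x ≤ y) (hy : y ≤ π) :
    (y - x) ^ 2 ≤ π ^ 2 / 2 * (cos x - cos y) := by
  have hpi := Real.pi_pos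
  set m := (x + y) / 2 with hm
  set d := (y - x) / 2 with hd
  have e : cos x - cos y = 2 * (sin m * sin d) := by
    rw [Real.cos_sub_cos, show (x - y) / 2 = - d by rw [hd]; ring, Real.sin_neg]
    ring
  have hd0 : 0 ≤ d := by rw [hd]; linarith
  have hd1 : d ≤ π / 2 := by rw [hd]; linarith
  have h1 : 2 / π * d ≤ sin d := Real.mul_le_sin hd0 hd1
  have h2 : sin d ≤ sin m := by
    rcases le_total m (π / 2) with h | h
    · exact Real.sin_le_sin_of_le_of_le_pi_div_two (by linarith) h (by rw [hd, hm]; linarith)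
    · rw [← Real.sin_pi_sub m]
      exact Real.sin_le_sin_of_le_of_le_pi_div_two (by linarith) (by linarith)
        (by rw [hd, hm]; linarith)
  have h3 : 0 ≤ 2 / π * d := by positivity
  have h4 : (2 / π * d) * (2 / π * d) ≤ sin m * sin d :=
    mul_le_mul (h1.trans h2) h1 h3 (h3.trans (h1.trans h2))
  rw [e]
  have h5 : (y - x) ^ 2 = π ^ 2 * ((2 / π * d) * (2 / π * d)) := by
    rw [hd]
    field_simp
  rw [h5]
  nlinarith [sq_nonneg π]

theorem volume_cos_mem_Icc_zero_pi_le (u : ℝ) {δ : ℝ} (hδ : 0 ≤ δ) :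
    volume {α ∈ Set.Icc 0 π | cos α ∈ Set.Icc u (u + δ)} ≤ ENNReal.ofReal (π * √δ) := by
  refine (Real.volume_le_diam _).trans ?_
  have main : ∀ x y, 0 ≤ x → x ≤ y → y ≤ π → cos x ≤ u + δ → u ≤ cos y → y - x ≤ π * √δ := by
    intro x y hx hxy hy h1 h2
    have h := sq_sub_le_cos_sub_cos hx hxy hy
    refine (sq_le_sq₀ (by linarith) (by positivity)).1 ?_
    rw [mul_pow, Real.sq_sqrt hδ]
    nlinarith [sq_nonneg π]
  apply Metric.ediam_le
  rintro x ⟨⟨hx0, hx1⟩, hx2, hx3⟩ y ⟨⟨hy0, hy1⟩, hy2, hy3⟩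
  rw [edist_dist]
  apply ENNReal.ofReal_le_ofReal
  rw [Real.dist_eq]
  rcases le_total x y with h | h
  · rw [abs_sub_comm, abs_of_nonneg (by linarith)]
    exact main x y hx0 h hy1 hx3 hy2
  · rw [abs_of_nonneg (by linarith)]
    exact main y x hy0 h hx1 hy3 hx2

theorem volume_cos_mem_Icc_neg_pi_pi_le (u : ℝ) {δ : ℝ} (hδ : 0 ≤ δ) :
    volume {α ∈ Set.Icc (-π) π | cos α ∈ Set.Icc u (u + δ)} ≤ ENNReal.ofReal (2 * π * √δ) := by
  set S := {α ∈ Set.Icc 0 π | cos α ∈ Set.Icc u (u + δ)} with hS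
  have hsub : {α ∈ Set.Icc (-π) π | cos α ∈ Set.Icc u (u + δ)} ⊆ S ∪ -S := by
    rintro α ⟨⟨h1, h2⟩, h3⟩
    rcases le_total 0 α with h | h
    · exact Or.inl ⟨⟨h, h2⟩, h3⟩
    · right
      refine ⟨⟨by linarith, by linarith⟩, ?_⟩
      rwa [Real.cos_neg]
  refine (measure_mono hsub).trans ((measure_union_le _ _).trans ?_)
  rw [Measure.measure_neg, ← two_mul]
  calc _ ≤ 2 * ENNReal.ofReal (π * √δ) := by
        gcongr
        exact volume_cos_mem_Icc_zero_pi_le u hδ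
    _ = _ := by
        rw [mul_assoc 2 π, ENNReal.ofReal_mul (by norm_num : (0:ℝ) ≤ 2)]
        simp

theorem volume_cos_sub_mem_Icc_le (u : ℝ) {δ β : ℝ} (hδ : 0 ≤ δ) (hβ : β ∈ Set.Icc (-π) π) :
    volume {α ∈ Set.Ioo (-π) π | cos (α - β) ∈ Set.Icc u (u + δ)} ≤
      ENNReal.ofReal (6 * π * √δ) := by
  set S := {α ∈ Set.Icc (-π) π | cos α ∈ Set.Icc u (u + δ)} with hS
  have hsub : {α ∈ Set.Ioo (-π) π | cos (α - β) ∈ Set.Icc u (u + δ)} ⊆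
      ((fun α => α + (-β)) ⁻¹' S) ∪ (((fun α => α + (2 * π - β)) ⁻¹' S) ∪
        ((fun α => α + (-2 * π - β)) ⁻¹' S)) := by
    rintro α ⟨⟨h1, h2⟩, h3⟩
    obtain ⟨hb1, hb2⟩ := hβ
    rcases lt_or_ge (α - β) (-π) with h | h
    · right; left
      refine ⟨⟨by linarith, by linarith⟩, ?_⟩
      beta_reduce
      rwa [show α + (2 * π - β) = α - β + 2 * π by ring, Real.cos_add_two_pi]
    · rcases lt_or_ge π (α - β) with h' | h'
      · right; right
        refine ⟨⟨by linarith, by linarith⟩, ?_⟩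
        beta_reduce
        rwa [show α + (-2 * π - β) = α - β - 2 * π by ring, Real.cos_sub_two_pi]
      · left
        refine ⟨⟨by linarith, by linarith⟩, ?_⟩
        beta_reduce
        rwa [← sub_eq_add_neg]
  refine (measure_mono hsub).trans ((measure_union_le _ _).trans ?_)
  grw [measure_union_le]
  simp only [measure_preimage_add_right]
  calc _ ≤ ENNReal.ofReal (2 * π * √δ) + (ENNReal.ofReal (2 * π * √δ) +
        ENNReal.ofReal (2 * π * √δ)) := by
        gcongr <;> exact volume_cos_mem_Icc_neg_pi_pi_le u hδ
    _ = _ := by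
        rw [← ENNReal.ofReal_add (by positivity) (by positivity),
          ← ENNReal.ofReal_add (by positivity) (by positivity)]
        congr 1
        ring

theorem summable_one_add_abs_int_rpow {q : ℝ} (hq : 1 < q) :
    Summable fun n : ℤ => (1 + |(n : ℝ)|) ^ (-q) := by
  have h : Summable fun n : ℕ => (1 + (n : ℝ)) ^ (-q) := by
    have := (summable_nat_add_iff 1).2 (Real.summable_nat_rpow.2 (show -q < -1 by linarith))
    simpa [add_comm] using this
  refine Summable.of_nat_of_neg ?_ ?_ <;> simpa using h

/-- The distance in the plane between `z` and the point with polar coordinates `(r, α)`. -/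
def polarDist (z : ℂ) (r α : ℝ) : ℝ := √((z.re - r * cos α) ^ 2 + (z.im - r * sin α) ^ 2)

theorem polarDist_nonneg (z : ℂ) (r α : ℝ) : 0 ≤ polarDist z r α := Real.sqrt_nonneg _

theorem polarDist_sq (z : ℂ) (r α : ℝ) :
    polarDist z r α ^ 2 = r ^ 2 + ‖z‖ ^ 2 - 2 * r * ‖z‖ * cos (α - z.arg) := by
  rw [polarDist, Real.sq_sqrt (by positivity), Real.cos_sub]
  have h1 : (‖z‖ * cos z.arg) = z.re := Complex.norm_mul_cos_arg z
  have h2 : (‖z‖ * sin z.arg) = z.im := Complex.norm_mul_sin_arg z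
  have h3 : ‖z‖ ^ 2 = z.re ^ 2 + z.im ^ 2 := by
    rw [Complex.sq_norm, Complex.normSq_apply]
    ring
  calc _ = r ^ 2 * (sin α ^ 2 + cos α ^ 2) + (z.re ^ 2 + z.im ^ 2)
        - 2 * r * (cos α * z.re + sin α * z.im) := by ring
    _ = _ := by
      rw [Real.sin_sq_add_cos_sq, ← h3]
      conv_lhs => rw [← h1, ← h2]
      ring

theorem abs_sub_norm_le_polarDist (z : ℂ) {r : ℝ} (hr : 0 ≤ r) (α : ℝ) :
    |r - ‖z‖| ≤ polarDist z r α := by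
  apply Real.le_sqrt_of_sq_le
  rw [sq_abs]
  have h := polarDist_sq z r α
  rw [polarDist, Real.sq_sqrt (by positivity)] at h
  rw [h]
  nlinarith [mul_le_mul_of_nonneg_left (Real.cos_le_one (α - z.arg))
    (mul_nonneg hr (norm_nonneg z))]

theorem volume_polarDist_mem_le {z : ℂ} (hz : z ≠ 0) {r : ℝ} (hr : 0 < r) {d : ℝ} (hd : 0 ≤ d) :
    volume {α ∈ Set.Ioo (-π) π | polarDist z r α ∈ Set.Ico d (d + 1)} ≤
      ENNReal.ofReal (6 * π * √((1 + d) / (r * ‖z‖))) := by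
  have hz' : 0 < ‖z‖ := norm_pos_iff.2 hz
  refine le_trans (measure_mono ?_) (volume_cos_sub_mem_Icc_le
    ((r ^ 2 + ‖z‖ ^ 2 - (d + 1) ^ 2) / (2 * (r * ‖z‖))) (β := z.arg) (by positivity)
    ⟨(Complex.neg_pi_lt_arg z).le, Complex.arg_le_pi z⟩)
  rintro α ⟨hα, h1, h2⟩
  have h := polarDist_sq z r α
  have hrz : 0 < r * ‖z‖ := by positivity
  have hlo : d ^ 2 ≤ polarDist z r α ^ 2 := by gcongr
  have hhi : polarDist z r α ^ 2 ≤ (d + 1) ^ 2 := by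
    have := polarDist_nonneg z r α
    gcongr
  refine ⟨hα, ?_, ?_⟩
  · rw [div_le_iff₀ (by positivity)]
    linarith
  · rw [div_add_div _ _ (by positivity) (by positivity), le_div_iff₀ (by positivity)]
    nlinarith

/-- Angular integral estimate: the circle of radius `r` meets the annuli around `z` in short
arcs. -/
theorem exists_lintegral_polarDist_le {q : ℝ} (hq : 1 < q) :
    ∃ C > 0, ∀ z : ℂ, z ≠ 0 → ∀ r > 0, ∀ c : ℝ,
      ∫⁻ α in Set.Ioo (-π) π, ENNReal.ofReal ((√(1 + polarDist z r α))⁻¹ *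
        (1 + |c - polarDist z r α|) ^ (-q)) ≤ ENNReal.ofReal (C * (√(r * ‖z‖))⁻¹) := by
  have hsum := summable_one_add_abs_int_rpow hq
  set T : ℝ := ∑' n : ℤ, (1 + |(n : ℝ)|) ^ (-q) with hT
  have hT0 : 0 ≤ T := tsum_nonneg fun n => by positivity
  refine ⟨6 * π * 2 ^ q * (T + 1), by positivity, fun z hz r hr c => ?_⟩
  have hz' : 0 < ‖z‖ := norm_pos_iff.2 hz
  set D : ℝ → ℝ := polarDist z r with hD
  set E : ℤ → Set ℝ := fun n => {α ∈ Set.Ioo (-π) π | ⌊D α⌋ = n} with hE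
  set m := ⌊c⌋ with hm
  have hcover : Set.Ioo (-π) π ⊆ ⋃ n, E n := fun α hα => Set.mem_iUnion.2 ⟨⌊D α⌋, hα, rfl⟩
  have hpiece : ∀ n : ℤ, ∫⁻ α in E n, ENNReal.ofReal ((√(1 + D α))⁻¹ * (1 + |c - D α|) ^ (-q)) ≤
      ENNReal.ofReal (6 * π * 2 ^ q * (√(r * ‖z‖))⁻¹ * (1 + |((m - n : ℤ) : ℝ)|) ^ (-q)) := by
    intro n
    rcases lt_or_ge n 0 with hn | hn
    · have : E n = ∅ := by
        ext α
        simp only [hE, Set.mem_ofPred_eq, Set.mem_empty_iff_false, iff_false, not_and]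
        intro _ h
        have : 0 ≤ ⌊D α⌋ := Int.floor_nonneg.2 (polarDist_nonneg z r α)
        omega
      simp [this]
    · have hn' : (0 : ℝ) ≤ n := by exact_mod_cast hn
      have hpt : ∀ α ∈ E n, ENNReal.ofReal ((√(1 + D α))⁻¹ * (1 + |c - D α|) ^ (-q)) ≤
          ENNReal.ofReal ((√(1 + n))⁻¹ * (2 ^ q * (1 + |((m - n : ℤ) : ℝ)|) ^ (-q))) := by
        rintro α ⟨-, hα⟩
        have h1 : (n : ℝ) ≤ D α := by rw [← hα]; exact Int.floor_le _
        have h2 : D α < n + 1 := by rw [← hα]; exact Int.lt_floor_add_one _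
        have h3 : (m : ℝ) ≤ c := Int.floor_le _
        have h4 : c < m + 1 := Int.lt_floor_add_one _
        apply ENNReal.ofReal_le_ofReal
        have h5 : (1 + |((m - n : ℤ) : ℝ)|) / 2 ≤ 1 + |c - D α| := by
          rcases eq_or_ne (m - n) 0 with h | h
          · rw [h]
            have := abs_nonneg (c - D α)
            norm_num
            linarith
          · have h6 : (1 : ℝ) ≤ |((m - n : ℤ) : ℝ)| := by
              exact_mod_cast Int.one_le_abs h
            have h7 : |((m - n : ℤ) : ℝ)| ≤ |c - D α| + 1 := by
              push_cast
              rw [abs_le]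
              constructor
              · linarith [neg_abs_le (c - D α)]
              · linarith [le_abs_self (c - D α)]
            linarith
        have h8 : (1 + |c - D α|) ^ (-q) ≤ 2 ^ q * (1 + |((m - n : ℤ) : ℝ)|) ^ (-q) := by
          calc _ ≤ ((1 + |((m - n : ℤ) : ℝ)|) / 2) ^ (-q) :=
                Real.rpow_le_rpow_of_nonpos (by positivity) h5 (by linarith)
            _ = _ := by
                rw [Real.div_rpow (by positivity) (by norm_num), Real.rpow_neg (by norm_num : (0:ℝ) ≤ 2),
                  div_inv_eq_mul, mul_comm]
        gcongr
      calc _ ≤ ∫⁻ _ in E n,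
            ENNReal.ofReal ((√(1 + n))⁻¹ * (2 ^ q * (1 + |((m - n : ℤ) : ℝ)|) ^ (-q))) :=
            setLIntegral_mono measurable_const hpt
        _ ≤ ENNReal.ofReal ((√(1 + n))⁻¹ * (2 ^ q * (1 + |((m - n : ℤ) : ℝ)|) ^ (-q))) *
            ENNReal.ofReal (6 * π * √((1 + n) / (r * ‖z‖))) := by
            rw [setLIntegral_const]
            gcongr
            refine le_trans (measure_mono ?_) (volume_polarDist_mem_le hz hr hn')
            rintro α ⟨hα, h⟩
            exact ⟨hα, Int.floor_eq_iff.1 h⟩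
        _ = _ := by
            rw [← ENNReal.ofReal_mul (by positivity), Real.sqrt_div (by positivity)]
            congr 1
            have : √(1 + (n : ℝ)) ≠ 0 := by positivity
            field_simp
  calc _ ≤ ∫⁻ α in ⋃ n, E n, ENNReal.ofReal ((√(1 + D α))⁻¹ * (1 + |c - D α|) ^ (-q)) :=
        lintegral_mono_set hcover
    _ ≤ ∑' n, ∫⁻ α in E n, ENNReal.ofReal ((√(1 + D α))⁻¹ * (1 + |c - D α|) ^ (-q)) :=
        lintegral_iUnion_le _ _
    _ ≤ ∑' n : ℤ, ENNReal.ofReal (6 * π * 2 ^ q * (√(r * ‖z‖))⁻¹ *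
          (1 + |((m - n : ℤ) : ℝ)|) ^ (-q)) := ENNReal.tsum_le_tsum hpiece
    _ = ∑' n : ℤ, ENNReal.ofReal (6 * π * 2 ^ q * (√(r * ‖z‖))⁻¹ * (1 + |(n : ℝ)|) ^ (-q)) :=
        (Equiv.subLeft m).tsum_eq (fun n : ℤ => ENNReal.ofReal (6 * π * 2 ^ q * (√(r * ‖z‖))⁻¹ *
          (1 + |(n : ℝ)|) ^ (-q)))
    _ = ENNReal.ofReal (6 * π * 2 ^ q * (√(r * ‖z‖))⁻¹ * T) := by
        rw [← ENNReal.ofReal_tsum_of_nonneg (fun n => by positivity) (hsum.mul_left _),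
          tsum_mul_left]
    _ ≤ _ := by
        apply ENNReal.ofReal_le_ofReal
        calc _ = 6 * π * 2 ^ q * T * (√(r * ‖z‖))⁻¹ := by ring
          _ ≤ _ := by gcongr; linarith

/-- The inverse weight `(1 + ρ²)^(-s) (1 + |c - ρ|)^(-2θ)`. -/
def invWt (s θ c ρ : ℝ) : ℝ := (1 + ρ ^ 2) ^ (-s) * (1 + |c - ρ|) ^ (-(2 * θ))

theorem invWt_nonneg (s θ c ρ : ℝ) : 0 ≤ invWt s θ c ρ := by
  unfold invWt
  positivity

theorem measurable_invWt (s θ : ℝ) : Measurable fun p : ℝ × ℝ => invWt s θ p.1 p.2 := by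
  unfold invWt
  fun_prop

theorem one_add_sq_rpow_neg_le {s x : ℝ} (hs : 0 ≤ s) (hx : 0 ≤ x) :
    (1 + x ^ 2) ^ (-s) ≤ 2 ^ s * (1 + x) ^ (-(2 * s)) := by
  have h : (1 + x) ^ 2 / 2 ≤ 1 + x ^ 2 := by nlinarith [sq_nonneg (x - 1)]
  calc _ ≤ ((1 + x) ^ 2 / 2) ^ (-s) := Real.rpow_le_rpow_of_nonpos (by positivity) h (by linarith)
    _ = _ := by
      rw [Real.div_rpow (by positivity) (by norm_num), Real.rpow_neg (by norm_num : (0:ℝ) ≤ 2),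
        div_inv_eq_mul, mul_comm, ← Real.rpow_natCast, ← Real.rpow_mul (by positivity)]
      congr 2
      push_cast
      ring

theorem exists_lintegral_invWt_le {s θ : ℝ} (hs : 1 / 4 < s) (hθ : 1 / 2 < θ) :
    ∃ C > 0, ∀ z : ℂ, z ≠ 0 → ∀ r > 0, ∀ c : ℝ,
      ∫⁻ α in Set.Ioo (-π) π, ENNReal.ofReal (r * (1 + r ^ 2) ^ (-s) *
        invWt s θ c (polarDist z r α)) ≤
      ENNReal.ofReal (C * (√‖z‖)⁻¹ *
        (r ^ (-(4 * s - 1)) + (1 + |r - ‖z‖|) ^ (-(4 * s - 1)))) := by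
  obtain ⟨C, hC, h⟩ := exists_lintegral_polarDist_le (q := 2 * θ) (by linarith)
  refine ⟨2 ^ s * C, by positivity, fun z hz r hr c => ?_⟩
  have hz' : 0 < ‖z‖ := norm_pos_iff.2 hz
  set y := (1 + |r - ‖z‖|) ^ (-(2 * s - 1 / 2)) with hy
  have hpt : ∀ α, r * (1 + r ^ 2) ^ (-s) * invWt s θ c (polarDist z r α) ≤
      (2 ^ s * (r * (1 + r ^ 2) ^ (-s)) * y) *
        ((√(1 + polarDist z r α))⁻¹ * (1 + |c - polarDist z r α|) ^ (-(2 * θ))) := by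
    intro α
    have hD0 := polarDist_nonneg z r α
    have hD1 := abs_sub_norm_le_polarDist z hr.le α
    rw [invWt]
    set D := polarDist z r α
    have h1 : (1 + D ^ 2) ^ (-s) ≤ 2 ^ s * (y * (√(1 + D))⁻¹) := by
      refine (one_add_sq_rpow_neg_le (by linarith) hD0).trans ?_
      have e : (1 + D) ^ (-(2 * s)) = (1 + D) ^ (-(2 * s - 1 / 2)) * (√(1 + D))⁻¹ := by
        rw [Real.sqrt_eq_rpow, ← Real.rpow_neg (by positivity), ← Real.rpow_add (by positivity)]
        congr 1
        ring
      rw [e]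
      gcongr
      exact Real.rpow_le_rpow_of_nonpos (by positivity) (by linarith) (by linarith)
    calc _ ≤ r * (1 + r ^ 2) ^ (-s) *
          ((2 ^ s * (y * (√(1 + D))⁻¹)) * (1 + |c - D|) ^ (-(2 * θ))) := by gcongr
      _ = _ := by ring
  calc _ ≤ ∫⁻ α in Set.Ioo (-π) π, ENNReal.ofReal (2 ^ s * (r * (1 + r ^ 2) ^ (-s)) * y) *
        ENNReal.ofReal ((√(1 + polarDist z r α))⁻¹ *
          (1 + |c - polarDist z r α|) ^ (-(2 * θ))) := by
        refine lintegral_mono fun α => ?_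
        rw [← ENNReal.ofReal_mul (by positivity)]
        exact ENNReal.ofReal_le_ofReal (hpt α)
    _ ≤ ENNReal.ofReal (2 ^ s * (r * (1 + r ^ 2) ^ (-s)) * y) *
        ENNReal.ofReal (C * (√(r * ‖z‖))⁻¹) := by
        rw [lintegral_const_mul' _ _ ENNReal.ofReal_ne_top]
        gcongr
        exact h z hz r hr c
    _ ≤ _ := by
        rw [← ENNReal.ofReal_mul (by positivity)]
        apply ENNReal.ofReal_le_ofReal
        have h2 : r * (1 + r ^ 2) ^ (-s) * (√r)⁻¹ ≤ r ^ (-(2 * s - 1 / 2)) := by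
          have h3 : (1 + r ^ 2) ^ (-s) ≤ r ^ (-(2 * s)) := by
            calc _ ≤ (r ^ 2) ^ (-s) :=
                  Real.rpow_le_rpow_of_nonpos (by positivity) (by linarith) (by linarith)
              _ = _ := by
                  rw [← Real.rpow_natCast, ← Real.rpow_mul hr.le]
                  congr 1
                  push_cast
                  ring
          calc _ ≤ r * r ^ (-(2 * s)) * (√r)⁻¹ := by gcongr
            _ = r ^ (1 : ℝ) * r ^ (-(2 * s)) * r ^ (-(1 / 2) : ℝ) := by
                rw [Real.rpow_one, Real.sqrt_eq_rpow, ← Real.rpow_neg hr.le]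
            _ = _ := by
                rw [← Real.rpow_add hr, ← Real.rpow_add hr]
                congr 1
                ring
        have sq_rpow : ∀ x : ℝ, 0 < x → (x ^ (-(2 * s - 1 / 2))) ^ 2 = x ^ (-(4 * s - 1)) := by
          intro x hx
          rw [← Real.rpow_natCast, ← Real.rpow_mul hx.le]
          congr 1
          push_cast
          ring
        rw [← sq_rpow r hr, ← sq_rpow _ (by positivity), ← hy]
        set x := r ^ (-(2 * s - 1 / 2))
        have hxy : x * y ≤ x ^ 2 + y ^ 2 := by nlinarith [sq_nonneg (x - y), sq_nonneg (x + y)]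
        rw [Real.sqrt_mul hr.le, mul_inv]
        calc _ = 2 ^ s * C * (√‖z‖)⁻¹ * ((r * (1 + r ^ 2) ^ (-s) * (√r)⁻¹) * y) := by ring
          _ ≤ 2 ^ s * C * (√‖z‖)⁻¹ * (x * y) := by gcongr
          _ ≤ _ := by gcongr

theorem lintegral_invWt_le_of_norm_le_one {s θ : ℝ} (hs : 1 / 4 < s) (hθ : 1 / 2 < θ) {z : ℂ}
    (hz : ‖z‖ ≤ 1) {r : ℝ} (hr : 0 < r) (c : ℝ) :
    ∫⁻ α in Set.Ioo (-π) π, ENNReal.ofReal (r * (1 + r ^ 2) ^ (-s) *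
        invWt s θ c (polarDist z r α)) ≤ ENNReal.ofReal (4 * π) := by
  have hpt : ∀ α, r * (1 + r ^ 2) ^ (-s) * invWt s θ c (polarDist z r α) ≤ 2 := by
    intro α
    have hD0 := polarDist_nonneg z r α
    have hD1 := abs_sub_norm_le_polarDist z hr.le α
    rw [invWt]
    set D := polarDist z r α
    have h1 : (1 + |c - D|) ^ (-(2 * θ)) ≤ 1 :=
      Real.rpow_le_one_of_one_le_of_nonpos (by linarith [abs_nonneg (c - D)]) (by linarith)
    have h3 : r ≤ D + 1 := by linarith [le_abs_self (r - ‖z‖)]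
    have h4 : r ^ 4 ≤ 16 * ((1 + r ^ 2) * (1 + D ^ 2)) := by
      have h5 : r ^ 2 ≤ 2 * (1 + D ^ 2) := by nlinarith [sq_nonneg (D - 1)]
      nlinarith [sq_nonneg r, sq_nonneg D]
    have h6 : r ≤ 2 * ((1 + r ^ 2) ^ (1 / 4 : ℝ) * (1 + D ^ 2) ^ (1 / 4 : ℝ)) := by
      calc r = (r ^ 4) ^ (1 / 4 : ℝ) := by
            rw [← Real.rpow_natCast, ← Real.rpow_mul hr.le]
            norm_num
        _ ≤ (16 * ((1 + r ^ 2) * (1 + D ^ 2))) ^ (1 / 4 : ℝ) := by gcongr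
        _ = _ := by
            rw [Real.mul_rpow (by norm_num) (by positivity),
              Real.mul_rpow (by positivity) (by positivity), show (16 : ℝ) = 2 ^ (4 : ℝ) by norm_num,
              ← Real.rpow_mul (by norm_num)]
            norm_num
    calc _ ≤ r * (1 + r ^ 2) ^ (-(1 / 4) : ℝ) * ((1 + D ^ 2) ^ (-(1 / 4) : ℝ) * 1) := by
          gcongr
          · linarith [sq_nonneg r]
          · linarith [sq_nonneg D]
      _ = r * ((1 + r ^ 2) ^ (1 / 4 : ℝ) * (1 + D ^ 2) ^ (1 / 4 : ℝ))⁻¹ := by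
          rw [Real.rpow_neg (by positivity), Real.rpow_neg (by positivity), mul_inv]
          ring
      _ ≤ 2 := by
          rw [← div_eq_mul_inv, div_le_iff₀ (by positivity)]
          exact h6
  calc _ ≤ ∫⁻ α in Set.Ioo (-π) π, ENNReal.ofReal 2 :=
        lintegral_mono fun α => ENNReal.ofReal_le_ofReal (hpt α)
    _ = _ := by
        rw [setLIntegral_const, Real.volume_Ioo, ← ENNReal.ofReal_mul (by norm_num)]
        congr 1
        ring

theorem lintegral_spaceTime_eq_polar {f : SpaceTime → ℝ≥0∞} (hf : Measurable f) :
    ∫⁻ η, f η = ∫⁻ r in Set.Ioi (0 : ℝ), ∫⁻ t : ℝ, ∫⁻ α in Set.Ioo (-π) π,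
      ENNReal.ofReal r * f !₂[t, r * cos α, r * sin α] := by
  let g : ℝ × ℝ × ℝ → ℝ≥0∞ := fun p => f !₂[p.1, p.2.1, p.2.2]
  have hg : Measurable g := hf.comp (by fun_prop)
  have h1 : ∫⁻ η, f η = ∫⁻ p : ℝ × ℝ × ℝ, g p := by
    rw [← (PiLp.volume_preserving_toLp (Fin 3)).lintegral_comp hf]
    have h2 := (volume_preserving_piFinSuccAbove (fun _ : Fin 3 => ℝ) 0)
    have h3 := ((MeasurePreserving.id (volume : Measure ℝ)).prod
      (volume_preserving_finTwoArrow ℝ)).comp h2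
    rw [← Measure.volume_eq_prod] at h3
    rw [← h3.lintegral_comp hg]
    refine lintegral_congr fun x => ?_
    simp only [g, Function.comp]
    congr 2
    ext i
    fin_cases i <;> rfl
  have h4 : Measurable fun q : ℝ × ℝ × ℝ =>
      ENNReal.ofReal q.1 * f !₂[q.2.1, q.1 * cos q.2.2, q.1 * sin q.2.2] := by
    refine Measurable.mul (by fun_prop) (hf.comp (by fun_prop))
  rw [h1, Measure.volume_eq_prod, lintegral_prod _ hg.aemeasurable]
  have h5 : ∀ t, ∫⁻ p : ℝ × ℝ, g (t, p) = ∫⁻ r in Set.Ioi (0 : ℝ), ∫⁻ α in Set.Ioo (-π) π,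
      ENNReal.ofReal r * f !₂[t, r * cos α, r * sin α] := by
    intro t
    rw [← lintegral_comp_polarCoord_symm, polarCoord_target, Measure.volume_eq_prod,
      ← Measure.prod_restrict, lintegral_prod]
    · rfl
    · exact (h4.comp (by fun_prop : Measurable fun p : ℝ × ℝ => (p.1, t, p.2))).aemeasurable
  simp_rw [h5]
  rw [lintegral_lintegral_swap]
  refine Measurable.aemeasurable ?_
  exact Measurable.lintegral_prod_right'
    (f := fun q : (ℝ × ℝ) × ℝ => ENNReal.ofReal q.1.2 * f !₂[q.1.1, q.1.2 * cos q.2, q.1.2 * sin q.2])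
    (h4.comp (by fun_prop : Measurable fun q : (ℝ × ℝ) × ℝ => (q.1.2, q.1.1, q.2)))

theorem exists_lintegral_abs_abs_sub_le {p : ℝ} (hp : 1 < p) :
    ∃ M > 0, ∀ r : ℝ, ∫⁻ t : ℝ, ENNReal.ofReal ((1 + |(|t| - r)|) ^ (-p)) ≤ ENNReal.ofReal M := by
  have hi : Integrable fun t : ℝ => (1 + |t|) ^ (-p) := by
    simpa using integrable_one_add_norm (E := ℝ) (μ := volume) (r := p) (by simpa using hp)
  have hfin : ∫⁻ t : ℝ, ENNReal.ofReal ((1 + |t|) ^ (-p)) ≠ ∞ := hi.lintegral_lt_top.ne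
  have hm : Measurable fun t : ℝ => ENNReal.ofReal ((1 + |t|) ^ (-p)) := by fun_prop
  set I := ∫⁻ t : ℝ, ENNReal.ofReal ((1 + |t|) ^ (-p))
  refine ⟨2 * I.toReal + 1, by positivity, fun r => ?_⟩
  calc _ ≤ ∫⁻ t : ℝ, (ENNReal.ofReal ((1 + |t - r|) ^ (-p)) +
          ENNReal.ofReal ((1 + |t + r|) ^ (-p))) := by
        refine lintegral_mono fun t => ?_
        rcases abs_cases t with ⟨h, -⟩ | ⟨h, -⟩
        · rw [h]
          exact le_self_add
        · rw [h, ← abs_neg (-t - r), show -(-t - r) = t + r by ring]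
          exact le_add_self
    _ = I + I := by
        rw [lintegral_add_left (by fun_prop),
          lintegral_sub_right_eq_self (fun t => ENNReal.ofReal ((1 + |t|) ^ (-p))),
          lintegral_add_right_eq_self (fun t => ENNReal.ofReal ((1 + |t|) ^ (-p)))]
    _ = ENNReal.ofReal (2 * I.toReal) := by
        rw [ENNReal.ofReal_mul (by norm_num), ENNReal.ofReal_toReal hfin]
        norm_num [two_mul]
    _ ≤ _ := ENNReal.ofReal_le_ofReal (by linarith)

theorem continuous_spFreq : Continuous spFreq := by
  unfold spFreq
  fun_prop

theorem spFreq_nonneg (ζ : SpaceTime) : 0 ≤ spFreq ζ := Real.sqrt_nonneg _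

theorem spFreq_polar (t : ℝ) {r : ℝ} (hr : 0 ≤ r) (α : ℝ) :
    spFreq !₂[t, r * cos α, r * sin α] = r := by
  have h : (r * cos α) ^ 2 + (r * sin α) ^ 2 = r ^ 2 := by
    linear_combination r ^ 2 * sin_sq_add_cos_sq α
  simp [spFreq, h, Real.sqrt_sq hr]

theorem spFreq_sub_polar (ζ : SpaceTime) (t r α : ℝ) :
    spFreq (ζ - !₂[t, r * cos α, r * sin α]) = polarDist ⟨ζ 1, ζ 2⟩ r α := by
  simp [spFreq, polarDist]

/-- The reciprocal of the squared weight of the wave-Sobolev norm. -/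
def invWeight (s θ : ℝ) (ζ : SpaceTime) : ℝ := invWt s θ |ζ 0| (spFreq ζ)

theorem measurable_invWeight (s θ : ℝ) : Measurable (invWeight s θ) :=
  (measurable_invWt s θ).comp
    (f := fun ζ : SpaceTime => (|ζ 0|, spFreq ζ)) (by
      have := continuous_spFreq.measurable
      fun_prop)

theorem setLIntegral_invWeight_le {s θ : ℝ} {M : ℝ}
    (hM : ∀ r : ℝ, ∫⁻ t : ℝ, ENNReal.ofReal ((1 + |(|t| - r)|) ^ (-(2 * θ))) ≤ ENNReal.ofReal M)
    {ζ : SpaceTime} {U : ℝ → ℝ≥0∞}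
    (hU : ∀ r > 0, ∀ c, ∫⁻ α in Set.Ioo (-π) π, ENNReal.ofReal (r * (1 + r ^ 2) ^ (-s) *
        invWt s θ c (polarDist ⟨ζ 1, ζ 2⟩ r α)) ≤ U r) {S : Set ℝ} (hS : MeasurableSet S) :
    ∫⁻ η in spFreq ⁻¹' S, ENNReal.ofReal (invWeight s θ η) * ENNReal.ofReal (invWeight s θ (ζ - η))
      ≤ ENNReal.ofReal M * ∫⁻ r in S ∩ Set.Ioi 0, U r := by
  have hmS : MeasurableSet (spFreq ⁻¹' S) := continuous_spFreq.measurable hS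
  have hm : Measurable fun η => ENNReal.ofReal (invWeight s θ η) *
      ENNReal.ofReal (invWeight s θ (ζ - η)) :=
    (measurable_invWeight s θ).ennreal_ofReal.mul
      ((measurable_invWeight s θ).comp (measurable_const.sub measurable_id)).ennreal_ofReal
  rw [← lintegral_indicator hmS, lintegral_spaceTime_eq_polar (hm.indicator hmS),
    ← lintegral_const_mul' _ _ ENNReal.ofReal_ne_top, ← Measure.restrict_restrict hS,
    ← lintegral_indicator hS]
  refine setLIntegral_mono' measurableSet_Ioi fun r hr => ?_
  have hr : 0 < r := hr
  by_cases hrS : r ∈ S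
  · rw [Set.indicator_of_mem hrS]
    calc _ ≤ ∫⁻ t : ℝ, ENNReal.ofReal ((1 + |(|t| - r)|) ^ (-(2 * θ))) * U r := by
          refine lintegral_mono fun t => ?_
          refine le_trans (le_of_eq ?_) (mul_le_mul_right (hU r hr |ζ 0 - t|) _)
          rw [← lintegral_const_mul' _ _ ENNReal.ofReal_ne_top]
          refine lintegral_congr fun α => ?_
          rw [Set.indicator_of_mem (by simpa [spFreq_polar t hr.le α] using hrS)]
          simp only [invWeight, spFreq_polar t hr.le α, spFreq_sub_polar]
          rw [← ENNReal.ofReal_mul (invWt_nonneg _ _ _ _), ← ENNReal.ofReal_mul hr.le,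
            ← ENNReal.ofReal_mul (by positivity)]
          congr 1
          simp [invWt]
          ring
      _ = (∫⁻ t : ℝ, ENNReal.ofReal ((1 + |(|t| - r)|) ^ (-(2 * θ)))) * U r :=
          lintegral_mul_const _ (by fun_prop)
      _ ≤ _ := by gcongr; exact hM r
  · rw [Set.indicator_of_notMem hrS]
    have h0 : ∀ t α, (spFreq ⁻¹' S).indicator (fun η => ENNReal.ofReal (invWeight s θ η) *
        ENNReal.ofReal (invWeight s θ (ζ - η))) !₂[t, r * cos α, r * sin α] = 0 := fun t α =>
      Set.indicator_of_notMem (by simpa [spFreq_polar t hr.le α] using hrS) _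
    simp [h0]

theorem preimage_floor_spFreq {L : ℝ} (hL : 0 < L) (n : ℤ) :
    (fun η => ⌊spFreq η / L⌋) ⁻¹' {n} = spFreq ⁻¹' Set.Ico (n * L) (n * L + L) := by
  ext η
  simp only [Set.mem_preimage, Set.mem_singleton_iff, Int.floor_eq_iff, Set.mem_Ico,
    le_div_iff₀ hL, div_lt_iff₀ hL]
  rw [add_mul, one_mul]

theorem exists_lintegral_fiber_invWeight_le {s θ : ℝ} (hs : 1 / 4 < s) (hs1 : s < 1 / 2)
    (hθ : 1 / 2 < θ) :
    ∃ C > 0, ∀ L ≥ 1, ∀ ζ : SpaceTime, spFreq ζ ≤ L → (L = 1 ∨ L / 2 ≤ spFreq ζ) → ∀ n : ℤ,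
      ∫⁻ η in (fun η => ⌊spFreq η / L⌋) ⁻¹' {n}, ENNReal.ofReal (invWeight s θ η) *
        ENNReal.ofReal (invWeight s θ (ζ - η)) ≤ ENNReal.ofReal (C * L ^ (3 / 2 - 4 * s)) := by
  obtain ⟨M, hM0, hM⟩ := exists_lintegral_abs_abs_sub_le (p := 2 * θ) (by linarith)
  obtain ⟨C, hC0, hC⟩ := exists_lintegral_invWt_le hs hθ
  set q := 4 * s - 1 with hq
  have hq0 : 0 < q := by linarith
  have hq1 : q < 1 := by linarith
  set K := 2 / (1 - q) + 1 with hK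
  have hK0 : 0 < K := by
    have : 0 < 1 - q := by linarith
    positivity
  refine ⟨M * (4 * π) + M * (C * (2 * (2 * K))), by positivity, fun L hL ζ hζ hcase n => ?_⟩
  have hL0 : 0 < L := by linarith
  have hz : ‖(⟨ζ 1, ζ 2⟩ : ℂ)‖ = spFreq ζ := by
    rw [Complex.norm_eq_sqrt_sq_add_sq, spFreq]
  rw [preimage_floor_spFreq hL0]
  rcases hcase with rfl | hcase
  · refine (setLIntegral_invWeight_le hM (U := fun _ => ENNReal.ofReal (4 * π))
      (fun r hr c => lintegral_invWt_le_of_norm_le_one hs hθ (by rwa [hz]) hr c)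
      measurableSet_Ico).trans ?_
    calc _ ≤ ENNReal.ofReal M * ENNReal.ofReal (4 * π) := by
          gcongr
          refine (lintegral_mono_set Set.inter_subset_left).trans ?_
          simp
      _ ≤ _ := by
          rw [← ENNReal.ofReal_mul hM0.le]
          refine ENNReal.ofReal_le_ofReal ?_
          rw [Real.one_rpow, mul_one]
          have : 0 ≤ M * (C * (2 * (2 * K))) := by positivity
          linarith
  · have hℓ0 : 0 < spFreq ζ := by linarith
    have hz0 : (⟨ζ 1, ζ 2⟩ : ℂ) ≠ 0 := norm_pos_iff.1 (by rwa [hz])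
    refine (setLIntegral_invWeight_le hM (fun r hr c => hC _ hz0 r hr c) measurableSet_Ico).trans ?_
    rw [hz]
    set ℓ := spFreq ζ
    have h1 : ∫⁻ r in Set.Ico (n * L) (n * L + L) ∩ Set.Ioi 0,
        ENNReal.ofReal (C * (√ℓ)⁻¹ * (r ^ (-q) + (1 + |r - ℓ|) ^ (-q))) ≤
        ENNReal.ofReal (C * (√ℓ)⁻¹) * (ENNReal.ofReal (K * L ^ (1 - q)) +
          ENNReal.ofReal (K * L ^ (1 - q))) := by
      calc _ ≤ ∫⁻ r in Set.Ico (n * L) (n * L + L) ∩ Set.Ioi 0, ENNReal.ofReal (C * (√ℓ)⁻¹) *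
            (ENNReal.ofReal (|r - 0| ^ (-q)) + ENNReal.ofReal (|r - ℓ| ^ (-q))) := by
            refine lintegral_mono_ae ?_
            filter_upwards [ae_restrict_mem (measurableSet_Ico.inter measurableSet_Ioi),
              ae_restrict_of_ae (Measure.ae_ne volume ℓ)] with r hr hrℓ
            have hr0 : 0 < r := hr.2
            have : 0 < |r - ℓ| := abs_pos.2 (sub_ne_zero.2 hrℓ)
            rw [← ENNReal.ofReal_add (by positivity) (by positivity),
              ← ENNReal.ofReal_mul (by positivity), sub_zero, abs_of_pos hr0]
            refine ENNReal.ofReal_le_ofReal ?_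
            gcongr _ * (_ + ?_)
            exact Real.rpow_le_rpow_of_nonpos this (by linarith) (by linarith)
        _ ≤ ∫⁻ r in Set.Ico (n * L) (n * L + L), ENNReal.ofReal (C * (√ℓ)⁻¹) *
            (ENNReal.ofReal (|r - 0| ^ (-q)) + ENNReal.ofReal (|r - ℓ| ^ (-q))) :=
            lintegral_mono_set Set.inter_subset_left
        _ ≤ _ := by
            rw [lintegral_const_mul' _ _ ENNReal.ofReal_ne_top, lintegral_add_left (by fun_prop)]
            gcongr
            · exact lintegral_Ico_abs_sub_rpow_neg_le hq0 hq1 hL0 _ _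
            · exact lintegral_Ico_abs_sub_rpow_neg_le hq0 hq1 hL0 _ _
    refine (mul_le_mul_right h1 _).trans ?_
    rw [← ENNReal.ofReal_add (by positivity) (by positivity),
      ← ENNReal.ofReal_mul (by positivity), ← ENNReal.ofReal_mul (by positivity)]
    refine ENNReal.ofReal_le_ofReal ?_
    have h2 : (√ℓ)⁻¹ ≤ 2 * L ^ (-(1 / 2) : ℝ) := by
      rw [Real.rpow_neg hL0.le, ← Real.sqrt_eq_rpow, ← div_eq_mul_inv,
        inv_le_comm₀ (Real.sqrt_pos.2 hℓ0) (by positivity), inv_div,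
        div_le_iff₀ (by norm_num)]
      refine Real.sqrt_le_iff.2 ⟨by positivity, ?_⟩
      rw [mul_pow, Real.sq_sqrt hℓ0.le]
      linarith
    have h3 : L ^ (-(1 / 2) : ℝ) * L ^ (1 - q) = L ^ (3 / 2 - 4 * s) := by
      rw [← Real.rpow_add hL0, hq]
      congr 1
      ring
    calc _ ≤ M * (C * (2 * L ^ (-(1 / 2) : ℝ)) * (K * L ^ (1 - q) + K * L ^ (1 - q))) := by gcongr
      _ = M * (C * (2 * (2 * K))) * (L ^ (-(1 / 2) : ℝ) * L ^ (1 - q)) := by ring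
      _ ≤ _ := by
          rw [h3]
          gcongr
          have : 0 ≤ M * (4 * π) := by positivity
          linarith

/-- The squared weight of the wave-Sobolev norm. -/
def weight (s θ : ℝ) (ζ : SpaceTime) : ℝ :=
  (1 + (spFreq ζ) ^ 2) ^ s * (1 + |(|ζ 0| - spFreq ζ)|) ^ (2 * θ)

theorem weight_nonneg (s θ : ℝ) (ζ : SpaceTime) : 0 ≤ weight s θ ζ := by
  unfold weight
  positivity

theorem measurable_weight (s θ : ℝ) : Measurable (weight s θ) := by
  have := continuous_spFreq.measurable
  unfold weight
  fun_prop

theorem invWeight_mul_weight (s θ : ℝ) (ζ : SpaceTime) : invWeight s θ ζ * weight s θ ζ = 1 := by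
  have h1 : 0 < 1 + spFreq ζ ^ 2 := by positivity
  have h2 : 0 < 1 + |(|ζ 0| - spFreq ζ)| := by positivity
  rw [invWeight, invWt, weight, Real.rpow_neg h1.le, Real.rpow_neg h2.le]
  have := (Real.rpow_pos_of_pos h1 s).ne'
  have := (Real.rpow_pos_of_pos h2 (2 * θ)).ne'
  field_simp

theorem ofReal_sqrt_sq {x : ℝ} (hx : 0 ≤ x) : ENNReal.ofReal √x ^ 2 = ENNReal.ofReal x := by
  rw [← ENNReal.ofReal_pow (Real.sqrt_nonneg x), Real.sq_sqrt hx]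

theorem spFreq_add_le (a b : SpaceTime) : spFreq (a + b) ≤ spFreq a + spFreq b := by
  have h : ∀ ζ : SpaceTime, spFreq ζ = ‖(⟨ζ 1, ζ 2⟩ : ℂ)‖ := fun ζ => by
    rw [Complex.norm_eq_sqrt_sq_add_sq, spFreq]
  rw [h, h, h]
  refine le_of_eq_of_le ?_ (norm_add_le _ _)
  congr 1

theorem spFreq_neg (a : SpaceTime) : spFreq (-a) = spFreq a := by
  simp [spFreq]

theorem abs_floor_spFreq_sub_le {L : ℝ} (hL : 0 < L) {ζ : SpaceTime} (hζ : spFreq ζ ≤ L)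
    (η : SpaceTime) : |⌊spFreq (ζ - η) / L⌋ - ⌊spFreq η / L⌋| ≤ 1 := by
  have h1 : spFreq (ζ - η) / L ≤ spFreq η / L + 1 := by
    have := spFreq_add_le ζ (-η)
    rw [spFreq_neg, ← sub_eq_add_neg] at this
    rw [div_add_one hL.ne']
    gcongr
    linarith
  have h2 : spFreq η / L ≤ spFreq (ζ - η) / L + 1 := by
    have := spFreq_add_le ζ (-(ζ - η))
    rw [spFreq_neg, ← sub_eq_add_neg, sub_sub_cancel] at this
    rw [div_add_one hL.ne']
    gcongr
    linarith
  have h3 := Int.floor_le_floor h1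
  have h4 := Int.floor_le_floor h2
  rw [Int.floor_add_one] at h3 h4
  rw [abs_le]
  constructor <;> linarith

theorem setLIntegral_sq_conv_le {s θ L B : ℝ} (hL : 0 < L) {A : Set SpaceTime}
    (hA : MeasurableSet A) (hAL : ∀ ζ ∈ A, spFreq ζ ≤ L)
    (hB : ∀ ζ ∈ A, ∀ n : ℤ, ∫⁻ η in (fun η => ⌊spFreq η / L⌋) ⁻¹' {n},
      ENNReal.ofReal (invWeight s θ η) * ENNReal.ofReal (invWeight s θ (ζ - η)) ≤ ENNReal.ofReal B)
    {f g : SpaceTime → ℝ≥0∞} (hf : Measurable f) (hg : Measurable g) :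
    ∫⁻ ζ in A, (∫⁻ η, f η * g (ζ - η)) ^ 2 ≤ 3 * ENNReal.ofReal B *
      (∫⁻ η, ENNReal.ofReal (weight s θ η) * f η ^ 2) *
        ∫⁻ η, ENNReal.ofReal (weight s θ η) * g η ^ 2 := by
  have hmw := measurable_weight s θ
  have hmi := measurable_invWeight s θ
  have hms := continuous_spFreq.measurable
  have hi0 : ∀ ζ, 0 ≤ invWeight s θ ζ := fun ζ => invWt_nonneg _ _ _ _
  have hk : ∀ ζ (x : ℝ≥0∞),
      ENNReal.ofReal √(invWeight s θ ζ) * (ENNReal.ofReal √(weight s θ ζ) * x) = x := fun ζ x => by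
    rw [← mul_assoc, ← ENNReal.ofReal_mul (Real.sqrt_nonneg _), ← Real.sqrt_mul (hi0 ζ),
      invWeight_mul_weight, Real.sqrt_one, ENNReal.ofReal_one, one_mul]
  have h := lintegral_sq_conv_le (κ := fun η => ⌊spFreq η / L⌋)
    (Int.measurable_floor.comp (hms.div_const L)) hA
    (fun ζ hζ η => abs_floor_spFreq_sub_le hL (hAL ζ hζ) η)
    (k := fun η => ENNReal.ofReal √(invWeight s θ η))
    (F := fun η => ENNReal.ofReal √(weight s θ η) * f η)
    (G := fun η => ENNReal.ofReal √(weight s θ η) * g η)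
    (by fun_prop) (by fun_prop) (by fun_prop)
    (B := ENNReal.ofReal B) (by
      intro ζ hζ n
      simpa only [ofReal_sqrt_sq (hi0 _)] using hB ζ hζ n)
  simpa only [hk, mul_pow, ofReal_sqrt_sq (weight_nonneg _ _ _)] using h

theorem rpow_le_of_mem_Icc {x : ℝ} (h1 : 1 / 4 ≤ x) (h2 : x ≤ 4) (σ : ℝ) : x ^ σ ≤ 4 ^ |σ| := by
  have hx : 0 < x := by linarith
  rcases le_total 0 σ with h | h
  · rw [abs_of_nonneg h]
    gcongr
  · rw [abs_of_nonpos h, Real.rpow_neg (by norm_num), ← Real.inv_rpow (by norm_num)]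
    exact Real.rpow_le_rpow_of_nonpos (by norm_num) (by linarith) h

/-- The points whose spatial frequency is comparable to `2 ^ j` (at most `1` when `j = 0`). -/
def dyadicShell (j : ℕ) : Set SpaceTime :=
  {ζ | spFreq ζ ≤ 2 ^ j ∧ (j = 0 ∨ 2 ^ j / 2 ≤ spFreq ζ)}

theorem measurableSet_dyadicShell (j : ℕ) : MeasurableSet (dyadicShell j) := by
  have := continuous_spFreq.measurable
  unfold dyadicShell
  measurability

theorem iUnion_dyadicShell : ⋃ j, dyadicShell j = Set.univ := by
  refine Set.eq_univ_of_forall fun ζ => Set.mem_iUnion.2 ?_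
  rcases le_total (spFreq ζ) 1 with h | h
  · exact ⟨0, by simpa using h, Or.inl rfl⟩
  · obtain ⟨n, hn1, hn2⟩ := exists_nat_pow_near h (one_lt_two : (1 : ℝ) < 2)
    exact ⟨n + 1, hn2.le, Or.inr (by rw [pow_succ]; linarith)⟩

theorem one_add_spFreq_sq_rpow_le {j : ℕ} {ζ : SpaceTime} (hζ : ζ ∈ dyadicShell j) (σ : ℝ) :
    (1 + spFreq ζ ^ 2) ^ σ ≤ 4 ^ |σ| * (2 ^ j : ℝ) ^ (2 * σ) := by
  have h0 := spFreq_nonneg ζ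
  have hL : (1 : ℝ) ≤ 2 ^ j := one_le_pow₀ one_le_two
  have hζ1 := hζ.1
  have h2 : (2 ^ j : ℝ) ^ 2 ≤ 4 * (1 + spFreq ζ ^ 2) := by
    rcases hζ.2 with rfl | h
    · nlinarith
    · nlinarith
  set L : ℝ := 2 ^ j
  have hL2 : 0 < L ^ 2 := by positivity
  have h3 := rpow_le_of_mem_Icc (x := (1 + spFreq ζ ^ 2) / L ^ 2)
    (by rw [le_div_iff₀ hL2]; linarith) (by rw [div_le_iff₀ hL2]; nlinarith) σ
  calc _ = ((1 + spFreq ζ ^ 2) / L ^ 2) ^ σ * (L ^ 2) ^ σ := by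
        rw [← Real.mul_rpow (by positivity) hL2.le, div_mul_cancel₀ _ hL2.ne']
    _ = ((1 + spFreq ζ ^ 2) / L ^ 2) ^ σ * L ^ (2 * σ) := by
        rw [Real.rpow_mul (by linarith)]
        norm_num
    _ ≤ _ := by gcongr

theorem exists_lintegral_sq_conv_le {s θ : ℝ} (hs : 1 / 4 < s) (hs1 : s < 1 / 2) (hθ : 1 / 2 < θ)
    {ε : ℝ} (hε : 0 < ε) :
    ∃ C > 0, ∀ f g : SpaceTime → ℝ≥0∞, Measurable f → Measurable g →
      ∫⁻ ζ, ENNReal.ofReal ((1 + spFreq ζ ^ 2) ^ (2 * s - 3 / 4 - ε)) *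
          (∫⁻ η, f η * g (ζ - η)) ^ 2 ≤
        ENNReal.ofReal C * (∫⁻ η, ENNReal.ofReal (weight s θ η) * f η ^ 2) *
          ∫⁻ η, ENNReal.ofReal (weight s θ η) * g η ^ 2 := by
  obtain ⟨C, hC0, hC⟩ := exists_lintegral_fiber_invWeight_le hs hs1 hθ
  set σ := 2 * s - 3 / 4 - ε with hσ
  set ρ : ℝ := 2 ^ (-(2 * ε)) with hρ
  have hρ0 : 0 < ρ := by positivity
  have hρ1 : ρ < 1 := Real.rpow_lt_one_of_one_lt_of_neg one_lt_two (by linarith)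
  have hsum := summable_geometric_of_lt_one hρ0.le hρ1
  set K : ℝ := 4 ^ |σ| * (3 * C)
  have hK : 0 < K := by positivity
  refine ⟨K * ∑' j : ℕ, ρ ^ j, by
    have := hsum.tsum_pos (fun j => by positivity) 0 (by positivity)
    positivity, fun f g hf hg => ?_⟩
  set P := (∫⁻ η, ENNReal.ofReal (weight s θ η) * f η ^ 2)
  set Q := (∫⁻ η, ENNReal.ofReal (weight s θ η) * g η ^ 2)
  have hj : ∀ j : ℕ, ∫⁻ ζ in dyadicShell j, ENNReal.ofReal ((1 + spFreq ζ ^ 2) ^ σ) *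
      (∫⁻ η, f η * g (ζ - η)) ^ 2 ≤ ENNReal.ofReal (K * ρ ^ j) * P * Q := by
    intro j
    have hL : (1 : ℝ) ≤ 2 ^ j := one_le_pow₀ one_le_two
    have hmain := setLIntegral_sq_conv_le (s := s) (θ := θ) (L := 2 ^ j)
      (B := C * (2 ^ j) ^ (3 / 2 - 4 * s)) (by positivity) (measurableSet_dyadicShell j)
      (fun ζ hζ => hζ.1) (fun ζ hζ n => hC _ hL ζ hζ.1
        (hζ.2.imp_left fun h => by rw [h, pow_zero]) n) hf hg
    calc _ ≤ ∫⁻ ζ in dyadicShell j, ENNReal.ofReal (4 ^ |σ| * (2 ^ j : ℝ) ^ (2 * σ)) *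
          (∫⁻ η, f η * g (ζ - η)) ^ 2 := by
          refine setLIntegral_mono' (measurableSet_dyadicShell j) fun ζ hζ => ?_
          gcongr
          exact one_add_spFreq_sq_rpow_le hζ σ
      _ = ENNReal.ofReal (4 ^ |σ| * (2 ^ j : ℝ) ^ (2 * σ)) *
          ∫⁻ ζ in dyadicShell j, (∫⁻ η, f η * g (ζ - η)) ^ 2 :=
          lintegral_const_mul' _ _ ENNReal.ofReal_ne_top
      _ ≤ ENNReal.ofReal (4 ^ |σ| * (2 ^ j : ℝ) ^ (2 * σ)) *
          (3 * ENNReal.ofReal (C * (2 ^ j) ^ (3 / 2 - 4 * s)) * P * Q) := by gcongr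
      _ = _ := by
          rw [← mul_assoc, ← mul_assoc, show (3 : ℝ≥0∞) = ENNReal.ofReal 3 by norm_num,
            ← ENNReal.ofReal_mul (by norm_num), ← ENNReal.ofReal_mul (by positivity)]
          congr 3
          have : (2 ^ j : ℝ) ^ (2 * σ) * (2 ^ j) ^ (3 / 2 - 4 * s) = ρ ^ j := by
            rw [← Real.rpow_add (by positivity), hσ, hρ, ← Real.rpow_natCast, ← Real.rpow_natCast,
              ← Real.rpow_mul (by norm_num), ← Real.rpow_mul (by norm_num)]
            congr 1
            ring
          rw [← this]
          ring
  calc _ = ∫⁻ ζ in ⋃ j, dyadicShell j, ENNReal.ofReal ((1 + spFreq ζ ^ 2) ^ σ) *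
      (∫⁻ η, f η * g (ζ - η)) ^ 2 := by rw [iUnion_dyadicShell, Measure.restrict_univ]
    _ ≤ ∑' j, ENNReal.ofReal (K * ρ ^ j) * P * Q :=
        (lintegral_iUnion_le _ _).trans (ENNReal.tsum_le_tsum hj)
    _ = _ := by
        rw [ENNReal.tsum_mul_right, ENNReal.tsum_mul_right, ← tsum_mul_left,
          ENNReal.ofReal_tsum_of_nonneg (fun j => by positivity) (hsum.mul_left K)]

theorem weight_mono {s s' : ℝ} (h : s ≤ s') (θ : ℝ) (ζ : SpaceTime) :
    weight s θ ζ ≤ weight s' θ ζ := by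
  unfold weight
  gcongr
  linarith [sq_nonneg (spFreq ζ)]

theorem weight_le_one_add_norm_pow {s θ : ℝ} (hs : s ≤ 1) (hθ : θ ≤ 1) (ζ : SpaceTime) :
    weight s θ ζ ≤ (1 + ‖ζ‖) ^ 4 := by
  have h0 := spFreq_nonneg ζ
  have hsq : ‖ζ‖ ^ 2 = ζ 0 ^ 2 + spFreq ζ ^ 2 := by
    rw [EuclideanSpace.norm_sq_eq, spFreq, Real.sq_sqrt (by positivity), Fin.sum_univ_three]
    simp only [Real.norm_eq_abs, sq_abs]
    ring
  have h1 : |ζ 0| ≤ ‖ζ‖ := abs_le_of_sq_le_sq (by nlinarith) (norm_nonneg ζ)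
  have h2 : spFreq ζ ≤ ‖ζ‖ := le_of_sq_le_sq (by nlinarith) (norm_nonneg ζ)
  have h3 : |(|ζ 0| - spFreq ζ)| ≤ ‖ζ‖ := abs_le.2 ⟨by linarith [abs_nonneg (ζ 0)], by linarith⟩
  calc weight s θ ζ ≤ (1 + spFreq ζ ^ 2) ^ (1 : ℝ) * (1 + |(|ζ 0| - spFreq ζ)|) ^ (2 : ℝ) := by
        unfold weight
        gcongr
        · linarith [sq_nonneg (spFreq ζ)]
        · linarith [abs_nonneg (|ζ 0| - spFreq ζ)]
        · linarith
    _ ≤ (1 + ‖ζ‖) ^ 2 * (1 + ‖ζ‖) ^ 2 := by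
        rw [Real.rpow_one, Real.rpow_two]
        gcongr
        nlinarith
    _ = _ := by ring

theorem integrable_weight_mul_sq {s θ : ℝ} (hs : s ≤ 1) (hθ : θ ≤ 1)
    (φ : SchwartzMap SpaceTime ℂ) : Integrable fun ζ => weight s θ ζ * ‖φ ζ‖ ^ 2 := by
  have hφ := φ.continuous
  have hmw := measurable_weight s θ
  obtain ⟨M, -, hM⟩ := φ.decay 0 0
  have hM' : ∀ ζ, ‖φ ζ‖ ≤ M := by simpa using hM
  have hd : Integrable fun ζ => M * (8 * (‖φ ζ‖ + ‖ζ‖ ^ 4 * ‖φ ζ‖)) := by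
    have h1 := φ.integrable_pow_mul volume 0
    simp only [pow_zero, one_mul] at h1
    exact ((h1.add (φ.integrable_pow_mul volume 4)).const_mul 8).const_mul M
  refine hd.mono' (by fun_prop) (ae_of_all _ fun ζ => ?_)
  have hw := weight_le_one_add_norm_pow hs hθ ζ
  have h4 : (1 + ‖ζ‖) ^ 4 ≤ 8 * (1 + ‖ζ‖ ^ 4) := by
    nlinarith [sq_nonneg (‖ζ‖ - 1), sq_nonneg (‖ζ‖ ^ 2 - 1), sq_nonneg (‖ζ‖ ^ 2 - ‖ζ‖),
      norm_nonneg ζ]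
  rw [Real.norm_of_nonneg (mul_nonneg (weight_nonneg _ _ _) (by positivity))]
  have hM0 : 0 ≤ M := (norm_nonneg _).trans (hM' 0)
  calc _ ≤ (8 * (1 + ‖ζ‖ ^ 4)) * (M * ‖φ ζ‖) := by
        rw [sq]
        gcongr
        · exact hw.trans h4
        · exact hM' ζ
    _ = _ := by ring

theorem lintegral_weight_mul_enorm_sq {s θ : ℝ} (hs : s ≤ 1) (hθ : θ ≤ 1)
    (v : SchwartzMap SpaceTime ℂ) :
    ∫⁻ ζ, ENNReal.ofReal (weight s θ ζ) * ‖𝓕 (fun x => v x) ζ‖ₑ ^ 2 =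
      ENNReal.ofReal (∫ ζ, weight s θ ζ * ‖𝓕 (fun x => v x) ζ‖ ^ 2) := by
  have hvint := integrable_weight_mul_sq hs hθ (𝓕 v)
  rw [SchwartzMap.fourier_coe] at hvint
  rw [ofReal_integral_eq_lintegral_ofReal hvint
    (ae_of_all _ fun ζ => mul_nonneg (weight_nonneg _ _ _) (by positivity))]
  refine lintegral_congr fun ζ => ?_
  rw [ENNReal.ofReal_mul (weight_nonneg _ _ _), ENNReal.ofReal_pow (norm_nonneg _), ofReal_norm]

theorem continuous_fourier_schwartz (v : SchwartzMap SpaceTime ℂ) :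
    Continuous (𝓕 (fun x => v x)) := by
  have h := (𝓕 v).continuous
  rwa [SchwartzMap.fourier_coe] at h

theorem continuous_fourier_mul (v w : SchwartzMap SpaceTime ℂ) :
    Continuous (𝓕 (fun x => v x * w x)) :=
  continuous_fourier_schwartz (SchwartzMap.pairing (ContinuousLinearMap.mul ℂ ℂ) v w)

theorem product_estimate_low (s' θ₁ : ℝ)
    (hs' : 1/4 < s') (hs'1 : s' ≤ 1/2) (hθ1 : 1/2 < θ₁) (hθ1b : θ₁ < 3/4) :
    ∀ ε : ℝ, 0 < ε → ∃ C > 0, ∀ v w : SchwartzMap SpaceTime ℂ,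
      waveNorm (2 * s' - 3/4 - ε) 0 (fun x => v x * w x) ≤
        C * waveNorm s' θ₁ (fun x => v x) * waveNorm s' θ₁ (fun x => w x) := by
  intro ε hε
  obtain ⟨δ, hδ0, hδ1, hδ2⟩ : ∃ δ > 0, δ < s' - 1 / 4 ∧ 2 * δ < ε := by
    have h := exists_between (show 0 < min (s' - 1 / 4) (ε / 2) by
      rw [lt_min_iff]; constructor <;> linarith)
    obtain ⟨δ, h0, h1⟩ := h
    rw [lt_min_iff] at h1
    exact ⟨δ, h0, h1.1, by linarith⟩
  obtain ⟨C, hC0, hC⟩ := exists_lintegral_sq_conv_le (s := s' - δ) (θ := θ₁) (by linarith)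
    (by linarith) hθ1 (ε := ε - 2 * δ) (by linarith)
  refine ⟨C ^ (1 / 2 : ℝ), by positivity, fun v w => ?_⟩
  have hmono : ∀ u : SchwartzMap SpaceTime ℂ,
      ∫⁻ ζ, ENNReal.ofReal (weight (s' - δ) θ₁ ζ) * ‖𝓕 (fun x => u x) ζ‖ₑ ^ 2 ≤
        ENNReal.ofReal (∫ ζ, weight s' θ₁ ζ * ‖𝓕 (fun x => u x) ζ‖ ^ 2) := fun u => by
    rw [← lintegral_weight_mul_enorm_sq (by linarith) (by linarith)]
    refine lintegral_mono fun ζ => ?_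
    gcongr
    exact weight_mono (by linarith) _ _
  have hnn : ∀ u : SchwartzMap SpaceTime ℂ,
      0 ≤ ∫ ζ, weight s' θ₁ ζ * ‖𝓕 (fun x => u x) ζ‖ ^ 2 := fun u =>
    integral_nonneg fun ζ => mul_nonneg (weight_nonneg _ _ _) (by positivity)
  have key : ∫ ζ, weight (2 * s' - 3 / 4 - ε) 0 ζ * ‖𝓕 (fun x => v x * w x) ζ‖ ^ 2 ≤
      C * (∫ ζ, weight s' θ₁ ζ * ‖𝓕 (fun x => v x) ζ‖ ^ 2) *
        ∫ ζ, weight s' θ₁ ζ * ‖𝓕 (fun x => w x) ζ‖ ^ 2 := by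
    have hcont := continuous_fourier_mul v w
    have hmw := measurable_weight (2 * s' - 3 / 4 - ε) 0
    rw [integral_eq_lintegral_of_nonneg_ae
      (ae_of_all _ fun ζ => mul_nonneg (weight_nonneg _ _ _) (by positivity)) (by fun_prop)]
    refine ENNReal.toReal_le_of_le_ofReal
      (mul_nonneg (mul_nonneg hC0.le (hnn v)) (hnn w)) ?_
    rw [ENNReal.ofReal_mul (mul_nonneg hC0.le (hnn v)), ENNReal.ofReal_mul hC0.le]
    calc _ ≤ ∫⁻ ζ, ENNReal.ofReal ((1 + spFreq ζ ^ 2) ^ (2 * (s' - δ) - 3 / 4 - (ε - 2 * δ))) *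
          (∫⁻ η, ‖𝓕 (fun x => v x) η‖ₑ * ‖𝓕 (fun x => w x) (ζ - η)‖ₑ) ^ 2 := by
          refine lintegral_mono fun ζ => ?_
          rw [ENNReal.ofReal_mul (weight_nonneg _ _ _), ENNReal.ofReal_pow (norm_nonneg _),
            ofReal_norm, show 2 * (s' - δ) - 3 / 4 - (ε - 2 * δ) = 2 * s' - 3 / 4 - ε by ring]
          gcongr
          · simp [weight]
          · exact enorm_fourier_mul_le v w ζ
      _ ≤ _ := hC _ _ (continuous_fourier_schwartz v).measurable.enorm
          (continuous_fourier_schwartz w).measurable.enorm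
      _ ≤ _ := by gcongr <;> exact hmono _
  have hfinal := Real.rpow_le_rpow (integral_nonneg fun ζ => mul_nonneg (weight_nonneg _ _ _)
    (by positivity)) key (by norm_num : (0 : ℝ) ≤ 1 / 2)
  rwa [Real.mul_rpow (mul_nonneg hC0.le (hnn v)) (hnn w), Real.mul_rpow hC0.le (hnn v)] at hfinal

end
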